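/- Assume T > R > P > S, 2R > T + S, 0 ≤ γ < 1 and γ² > (T−R)/(T−P). Let τ be the retarded Grim strategy: τ(s1,s2) = C if s2 = (C,C) and τ(s1,s2) = D otherwise (note τ(π(s1),π(s2)) = τ(s1,s2), so the mirrored strategy coincides with τ). Then there exists Q : {C,D} × Ω × Ω → ℝ satisfying the player-1 memory-two Bellman optimality equation against τ such that for all states s1, s2: if s2 = (C,C) then Q(C,s1,s2) > Q(D,s1,s2), and if s2 ≠ (C,C) then Q(D,s1,s2) > Q(C,s1,s2); that is, a pair of retarded Grim strategies forms a symmetric mutual reinforcement learning equilibrium. -/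

import Mathlib

inductive Act where
  | C : Act
  | D : Act
deriving DecidableEq

open Act

abbrev St : Type := Act × Act

/-- Player 1's payoff in the prisoner's dilemma. -/
def r1 (R S T P : ℝ) : Act → Act → ℝ
  | C, C => R
  | C, D => S
  | D, C => T
  | D, D => P

/-- Swap the roles of the two players in a state. -/
def pi' (s : St) : St := (s.2, s.1)

/-- the retarded Grim strategy forms a symmetric mutual reinforcement learning
equilibrium when `γ² > (T−R)/(T−P)`. -/
theorem stmt_6 (R S T P γ : ℝ) (hTR : T > R) (hRP : R > P) (hPS : P > S)
    (h2R : 2 * R > T + S) (hγ0 : 0 ≤ γ) (hγ1 : γ < 1)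
    (hγ2 : γ ^ 2 > (T - R) / (T - P))
    (τ : St → St → Act) (hτ : ∀ s1 s2, τ s1 s2 = if s2 = (C, C) then C else D) :
    ∃ Q : Act → St → St → ℝ,
      (∀ σ s1 s2, Q σ s1 s2 =
        r1 R S T P σ (τ s1 s2) +
          γ * max (Q C (σ, τ s1 s2) s1) (Q D (σ, τ s1 s2) s1)) ∧
      (∀ s1 s2 : St, (s2 = (C, C) → Q C s1 s2 > Q D s1 s2) ∧
        (s2 ≠ (C, C) → Q D s1 s2 > Q C s1 s2)) := by
  have hTP : 0 < T - P := by linarith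
  have hk : 0 < 1 - γ ^ 2 := by nlinarith
  have hkey : T - R < γ ^ 2 * (T - P) := (div_lt_iff₀ hTP).mp hγ2
  obtain ⟨k, hk1⟩ : ∃ k : ℝ, k * (1 - γ ^ 2) = 1 := ⟨(1 - γ ^ 2)⁻¹, inv_mul_cancel₀ hk.ne'⟩
  have hk0 : 0 < k := pos_of_mul_pos_left (one_pos.trans_eq hk1.symm) hk.le
  have hdev : T - R < γ * k * (γ * (R - P)) := by
    nlinarith [mul_pos hk0 (sub_pos.mpr hkey)]
  -- Along the play of two retarded Grim strategies, stage payoffs alternate between `g s2` and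
  -- `g s1`, so the value of `(s1, s2)` is `k * (g s2 + γ * g s1)`.
  let g : St → ℝ := fun s => if s = (C, C) then R else P
  let Q : Act → St → St → ℝ := fun σ s1 s2 =>
    r1 R S T P σ (τ s1 s2) + γ * (k * (g s1 + γ * g (σ, τ s1 s2)))
  have hC : ∀ s1 s2 : St, s2 = (C, C) → Q C s1 s2 > Q D s1 s2 := by
    intro s1 s2 h
    simp only [Q, g, hτ, h, r1]
    simp
    linarith
  have hD : ∀ s1 s2 : St, s2 ≠ (C, C) → Q D s1 s2 > Q C s1 s2 := by
    intro s1 s2 h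
    simp only [Q, g, hτ, h, r1]
    simpa using hPS
  have hmax : ∀ s1 s2 : St, max (Q C s1 s2) (Q D s1 s2) = k * (g s2 + γ * g s1) := by
    intro s1 s2
    by_cases h : s2 = (C, C)
    · rw [max_eq_left (hC s1 s2 h).le]
      simp only [Q, hτ, h, if_true, r1, show g (C, C) = R from if_pos rfl]
      linear_combination (-R) * hk1
    · rw [max_eq_right (hD s1 s2 h).le]
      simp only [Q, hτ, h, if_false, r1, show g (D, D) = P from if_neg (by decide),
        show g s2 = P from if_neg h]
      linear_combination (-P) * hk1
  refine ⟨Q, fun σ s1 s2 => ?_, fun s1 s2 => ⟨hC s1 s2, hD s1 s2⟩⟩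
  rw [hmax]
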